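/- Let ε = k0m·(√(θ/k0l) + 1 − θ/(k0l·(√(θ/k0l) + 1))). Then ε > 0, and for every natural number i with i ≥ √(θ/k0l) + 1 and every feasible toll vector u, v i − Σ_{y=0}^∞ p i y u · v y > ε (a uniform negative-drift / Foster–Lyapunov condition). -/

import Mathlib

theorem poisson_affine_hasSum (l a c : ℝ) :
    HasSum (fun y : ℕ => Real.exp (-l) * l ^ y / (Nat.factorial y : ℝ) * (a * y + c))
      (a * l + c) := by
  have h0 : HasSum (fun y : ℕ => l ^ y / (Nat.factorial y : ℝ)) (Real.exp l) := by
    rw [Real.exp_eq_exp_ℝ]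
    exact NormedSpace.expSeries_div_hasSum_exp l
  have h1 : HasSum (fun y : ℕ => (y : ℝ) * (l ^ y / (Nat.factorial y : ℝ)))
      (l * Real.exp l) := by
    rw [← hasSum_nat_add_iff' 1]
    simp only [Finset.sum_range_one, Nat.cast_zero, zero_mul, sub_zero]
    refine (h0.mul_left l).congr_fun ?_
    intro y
    have h2 : ((Nat.factorial y : ℕ) : ℝ) ≠ 0 := by positivity
    have h3 : ((y : ℝ) + 1) ≠ 0 := by positivity
    rw [Nat.factorial_succ]
    push_cast
    field_simp
    ring
  have h2 := ((h1.mul_left a).add (h0.mul_left c)).mul_left (Real.exp (-l))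
  have he : Real.exp (-l) * Real.exp l = 1 := by
    rw [← Real.exp_add]; simp
  have e : Real.exp (-l) * (a * (l * Real.exp l) + c * Real.exp l) = a * l + c := by
    linear_combination (a * l + c) * he
  rw [e] at h2
  refine h2.congr_fun ?_
  intro y
  ring

theorem stmt3
    (R : ℕ) (hR : 1 ≤ R)
    (θ τmin τmax : ℝ) (hθ : 0 < θ) (hτmin : 0 < τmin) (hττ : τmin ≤ τmax)
    (TSTT : ℕ → (Fin R → ℝ) → ℝ)
    (k0l k0m : ℝ) (kl km : Fin R → ℝ)
    (hk0l : 0 < k0l) (hk0 : k0l ≤ k0m)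
    (hklpos : ∀ r, 0 < kl r) (hklm : ∀ r, kl r ≤ km r)
    (hTSTT_lb : ∀ (x : ℕ) (u : Fin R → ℝ), (∀ r, τmin ≤ u r ∧ u r ≤ τmax) →
      k0l * x + ∑ r, kl r * u r ≤ TSTT x u)
    (hTSTT_ub : ∀ (x : ℕ) (u : Fin R → ℝ), (∀ r, τmin ≤ u r ∧ u r ≤ τmax) →
      TSTT x u ≤ k0m * x + ∑ r, km r * u r)
    (p : ℕ → ℕ → (Fin R → ℝ) → ℝ)
    (hp : ∀ (x y : ℕ) (u : Fin R → ℝ), p x y u =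
      Real.exp (-(θ / TSTT x u)) * (θ / TSTT x u) ^ y / (Nat.factorial y : ℝ))
    (v : ℕ → ℝ) (hv : ∀ i : ℕ, v i = k0m * i + ∑ r, km r * τmax)
 :
    0 < k0m * (Real.sqrt (θ / k0l) + 1 - θ / (k0l * (Real.sqrt (θ / k0l) + 1))) ∧
    ∀ (i : ℕ) (u : Fin R → ℝ), (∀ r, τmin ≤ u r ∧ u r ≤ τmax) →
      Real.sqrt (θ / k0l) + 1 ≤ (i : ℝ) →
      v i - (∑' y : ℕ, p i y u * v y) >
        k0m * (Real.sqrt (θ / k0l) + 1 - θ / (k0l * (Real.sqrt (θ / k0l) + 1))) := by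
  have hk0m : 0 < k0m := lt_of_lt_of_le hk0l hk0
  have hs0 : 0 ≤ Real.sqrt (θ / k0l) := Real.sqrt_nonneg _
  have hsq : Real.sqrt (θ / k0l) ^ 2 = θ / k0l := Real.sq_sqrt (by positivity)
  have hθs : θ = Real.sqrt (θ / k0l) ^ 2 * k0l := by rw [hsq]; field_simp
  set s := Real.sqrt (θ / k0l) with hs
  constructor
  · apply mul_pos hk0m
    rw [sub_pos, div_lt_iff₀ (by positivity)]
    nlinarith [mul_nonneg hs0 hk0l.le]
  · intro i u hu hi
    have hsum : 0 < ∑ r, kl r * u r := by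
      apply Finset.sum_pos
      · intro r _
        exact mul_pos (hklpos r) (lt_of_lt_of_le hτmin (hu r).1)
      · exact ⟨⟨0, hR⟩, Finset.mem_univ _⟩
    have hlb := hTSTT_lb i u hu
    have hT : k0l * (s + 1) < TSTT i u := by
      have := mul_le_mul_of_nonneg_left hi hk0l.le
      linarith
    have hl : θ / TSTT i u < θ / (k0l * (s + 1)) :=
      div_lt_div_of_pos_left hθ (by positivity) hT
    have ht : (∑' y : ℕ, p i y u * v y) = k0m * (θ / TSTT i u) + ∑ r, km r * τmax := by
      simp only [hp, hv]
      exact (poisson_affine_hasSum _ _ _).tsum_eq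
    rw [ht, hv]
    have a1 := mul_lt_mul_of_pos_left hl hk0m
    have a2 := mul_le_mul_of_nonneg_left hi hk0m.le
    linarith
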